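/- arXiv:2502.12341 — 2 statements merged into one kernel-verified Lean document; each statement's English description precedes it below -/
import Mathlib

section
/- Let p be a prime number and let S be a perfect commutative ring of characteristic p (i.e. the Frobenius endomorphism x ↦ x^p of S is bijective). Let a₁, …, a_k ∈ S and set I = (a₁, …, a_k), and assume that S is separated and complete for the I-adic topology. Let W(S) denote the ring of p-typical Witt vectors of S and let [·] : S → W(S) be the Teichmüller map. Then W(S) is separated and complete for the J-adic topology, where J is the ideal of W(S) generated by p together with the Teichmüller representatives [a₁], …, [a_k]. -/
namespace WittVector

variable {p : ℕ} [Fact p.Prime] {S : Type*} [CommRing S]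

/-- In a precomplete ring, every sequence that is Cauchy for the adic topology, without a prescribed
rate, converges. -/
theorem _root_.Ideal.exists_limit_of_cauchy (I : Ideal S) [IsPrecomplete I S] {f : ℕ → S}
    (hf : ∀ n, ∃ M, ∀ N ≥ M, f M - f N ∈ I ^ n) :
    ∃ z, ∀ n, ∃ M, ∀ N ≥ M, f N - z ∈ I ^ n := by
  choose φ hφ using hf
  have hcauchy {n N : ℕ} (hN : partialSups φ n ≤ N) :
      f (partialSups φ n) - f N ∈ I ^ n := by
    have h := sub_mem (hφ n N ((le_partialSups φ n).trans hN)) (hφ n _ (le_partialSups φ n))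
    simpa using h
  obtain ⟨z, hz⟩ := IsPrecomplete.prec ‹IsPrecomplete I S›
    (f := fun n => f (partialSups φ n)) fun {m n} hmn => by
      simpa only [smul_eq_mul, Ideal.mul_top, SModEq.sub_mem] using
        hcauchy ((partialSups φ).monotone hmn)
  simp only [smul_eq_mul, Ideal.mul_top, SModEq.sub_mem] at hz
  refine ⟨z, fun n => ⟨partialSups φ n, fun N hN => ?_⟩⟩
  simpa using sub_mem (hz n) (hcauchy hN)

/-- The ideal of Witt vectors whose first `m` coefficients lie in `I`. -/
noncomputable def coeffIdeal (p : ℕ) [Fact p.Prime] (I : Ideal S) (m : ℕ) :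
    Ideal (WittVector p S) :=
  RingHom.ker ((truncate m).comp (map (Ideal.Quotient.mk I)))

theorem sub_mem_coeffIdeal {I : Ideal S} {m : ℕ} {x y : WittVector p S} :
    x - y ∈ coeffIdeal p I m ↔ ∀ i < m, x.coeff i - y.coeff i ∈ I := by
  rw [coeffIdeal, ← RingHom.comap_ker, Ideal.mem_comap, map_sub, mem_ker_truncate,
    ← le_coeff_eq_iff_le_sub_coeff_eq_zero]
  simp only [map_coeff, Ideal.Quotient.mk_eq_mk_iff_sub_mem]

theorem mem_coeffIdeal {I : Ideal S} {m : ℕ} {x : WittVector p S} :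
    x ∈ coeffIdeal p I m ↔ ∀ i < m, x.coeff i ∈ I := by
  simpa using sub_mem_coeffIdeal (I := I) (m := m) (x := x) (y := 0)

theorem teichmuller_mem_coeffIdeal {I : Ideal S} {z : S} (hz : z ∈ I) (m : ℕ) :
    teichmuller p z ∈ coeffIdeal p I m := by
  rw [mem_coeffIdeal]
  rintro (_ | i) -
  · simpa using hz
  · simp [teichmuller_coeff_pos]

/-- The kernel of `W(S) → W(S/I)`, i.e. the Witt vectors all of whose coefficients lie in `I`. -/
theorem mem_ker_map_mk {I : Ideal S} {x : WittVector p S} :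
    x ∈ RingHom.ker (map (p := p) (Ideal.Quotient.mk I)) ↔ ∀ i, x.coeff i ∈ I := by
  simp [RingHom.mem_ker, WittVector.ext_iff, map_coeff, Ideal.Quotient.eq_zero_iff_mem]

/-- The ideal generated by `p` and the Teichmüller representatives of the elements of `s`. -/
noncomputable def teichmullerIdeal (p : ℕ) [Fact p.Prime] (s : Set S) : Ideal (WittVector p S) :=
  Ideal.span ({(p : WittVector p S)} ∪ teichmuller p '' s)

theorem p_mem_teichmullerIdeal (s : Set S) : (p : WittVector p S) ∈ teichmullerIdeal p s :=
  Ideal.subset_span (Or.inl rfl)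

open scoped Pointwise in
/-- Every element of `(s)ⁿ` lifts to an element of `([s])ⁿ` all of whose coefficients lie in
`(s)ⁿ`. -/
theorem exists_mem_pow_teichmullerIdeal (s : Set S) (n : ℕ) {z : S} (hz : z ∈ Ideal.span s ^ n) :
    ∃ w ∈ teichmullerIdeal p s ^ n, w.coeff 0 = z ∧ ∀ i, w.coeff i ∈ Ideal.span s ^ n := by
  set T : Ideal (WittVector p S) := Ideal.span (teichmuller p '' (s ^ n)) with hT
  have hspan : Ideal.span s ^ n = Ideal.span (s ^ n) := Submodule.span_pow s n
  have hmap : T.map constantCoeff = Ideal.span s ^ n := by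
    rw [hT, Ideal.map_span, hspan, Set.image_image]
    simp
  rw [← hmap, Ideal.mem_map_iff_of_surjective _ (constantCoeff_surjective p)] at hz
  obtain ⟨w, hw, rfl⟩ := hz
  refine ⟨w, ?_, rfl, mem_ker_map_mk.1 ?_⟩
  · have : T = Ideal.span (teichmuller p '' s) ^ n := by
      rw [hT, Set.image_pow]
      exact (Submodule.span_pow _ n).symm
    rw [this] at hw
    exact Ideal.pow_right_mono (Ideal.span_mono Set.subset_union_right) n hw
  · refine Ideal.span_le.2 ?_ hw
    rintro _ ⟨z, hz, rfl⟩
    have hz' : z ∈ Ideal.span s ^ n := hspan ▸ Ideal.subset_span hz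
    simp [RingHom.mem_ker, Ideal.Quotient.eq_zero_iff_mem.2 hz']

section CharP

variable [CharP S p]

theorem exists_teichmullerIdeal_pow_le_coeffIdeal {s : Set S} (hs : s.Finite) (m n : ℕ) :
    ∃ N, teichmullerIdeal p s ^ N ≤ coeffIdeal p (Ideal.span s ^ n) m := by
  refine Ideal.exists_pow_le_of_le_radical_of_fg (Ideal.span_le.2 ?_)
    (Submodule.fg_span ((Set.finite_singleton _).union (hs.image _)))
  rintro _ (rfl | ⟨z, hz, rfl⟩)
  · refine ⟨m, mem_coeffIdeal.2 fun i hi => ?_⟩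
    rw [coeff_p_pow_eq_zero p S hi.ne]
    exact zero_mem _
  · refine ⟨n, ?_⟩
    rw [← map_pow]
    exact teichmuller_mem_coeffIdeal (Ideal.pow_mem_pow (Ideal.subset_span hz) n) m

theorem isHausdorff_teichmullerIdeal {s : Set S} (hs : s.Finite)
    [IsHausdorff (Ideal.span s) S] :
    IsHausdorff (teichmullerIdeal p s) (WittVector p S) where
  haus' x hx := by
    ext i
    rw [zero_coeff]
    refine IsHausdorff.haus ‹_› _ fun n => ?_
    obtain ⟨N, hN⟩ := exists_teichmullerIdeal_pow_le_coeffIdeal (p := p) hs (i + 1) n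
    have h := hx N
    simp only [smul_eq_mul, Ideal.mul_top, SModEq.zero] at h ⊢
    exact mem_coeffIdeal.1 (hN h) i i.lt_succ_self

variable [PerfectRing S p]

/-- In a perfect ring, extracting `p`-th roots is continuous for the adic topology of a finitely
generated ideal. -/
theorem _root_.Ideal.exists_mem_of_pow_char_mem_pow {I : Ideal S} (hI : I.FG) (n : ℕ) :
    ∃ l, ∀ x : S, x ^ p ∈ I ^ l → x ∈ I ^ n := by
  obtain ⟨l, hl⟩ : ∃ l, I ^ l ≤ (I ^ n).map (_root_.frobeniusEquiv S p) := by
    refine Ideal.exists_pow_le_of_le_radical_of_fg (fun x hx => ⟨n * p, ?_⟩) hI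
    rw [pow_mul]
    exact Ideal.mem_map_of_mem _ (Ideal.pow_mem_pow hx n)
  refine ⟨l, fun x hx => ?_⟩
  obtain ⟨y, hy, hyx⟩ := (Ideal.mem_map_of_equiv (_root_.frobeniusEquiv S p) _).1 (hl hx)
  rwa [← (_root_.frobeniusEquiv S p).injective (a₁ := y) (a₂ := x) hyx]

theorem exists_mem_pow_teichmullerIdeal_of_coeff_mem {s : Set S} (hs : s.Finite) (N : ℕ) :
    ∃ n, ∀ x : WittVector p S, (∀ i, x.coeff i ∈ Ideal.span s ^ n) →
      x ∈ teichmullerIdeal p s ^ N := by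
  induction N with
  | zero => exact ⟨0, by simp⟩
  | succ N ih =>
    obtain ⟨n, hn⟩ := ih
    obtain ⟨l, hl⟩ := Ideal.exists_mem_of_pow_char_mem_pow (p := p) (Submodule.fg_span hs) n
    refine ⟨l + (N + 1), fun x hx => ?_⟩
    obtain ⟨w, hwJ, hw0, hw⟩ := exists_mem_pow_teichmullerIdeal (p := p) s _ (hx 0)
    have hsub : ∀ i, (x - w).coeff i ∈ Ideal.span s ^ (l + (N + 1)) :=
      mem_ker_map_mk.1 (sub_mem (mem_ker_map_mk.2 hx) (mem_ker_map_mk.2 hw))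
    have h0 : (x - w).coeff 0 = 0 := by
      change constantCoeff (x - w) = 0
      rw [map_sub]
      exact sub_eq_zero.2 hw0.symm
    obtain ⟨y, hy⟩ :=
      Ideal.mem_span_singleton'.1 ((mem_span_p_iff_coeff_zero_eq_zero _).2 h0)
    have hyJ : y ∈ teichmullerIdeal p s ^ N := hn y fun i => hl _ <| by
      rw [← mul_charP_coeff_succ, hy]
      exact Ideal.pow_le_pow_right (Nat.le_add_right _ _) (hsub _)
    rw [← sub_add_cancel x w, ← hy]
    refine add_mem ?_ (Ideal.pow_le_pow_right (Nat.le_add_left _ _) hwJ)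
    rw [pow_succ]
    exact Ideal.mul_mem_mul hyJ (p_mem_teichmullerIdeal s)

theorem exists_coeffIdeal_le_teichmullerIdeal_pow {s : Set S} (hs : s.Finite) (N : ℕ) :
    ∃ n, coeffIdeal p (Ideal.span s ^ n) N ≤ teichmullerIdeal p s ^ N := by
  obtain ⟨n, hn⟩ := exists_mem_pow_teichmullerIdeal_of_coeff_mem (p := p) hs N
  refine ⟨n, fun x hx => ?_⟩
  rw [← init_add_tail x N]
  refine add_mem (hn _ fun i => ?_) ?_
  · by_cases hi : i < N
    · simpa [init, select, coeff_mk, hi] using mem_coeffIdeal.1 hx i hi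
    · simp [init, select, coeff_mk, hi]
  · have : tail N x ∈ Ideal.span {(p ^ N : WittVector p S)} :=
      (mem_span_p_pow_iff_le_coeff_eq_zero _ _).2 fun i hi => by
        simp [tail, select, coeff_mk, not_le.2 hi]
    refine (Ideal.span_singleton_le_iff_mem _).2 ?_ this
    exact Ideal.pow_mem_pow (p_mem_teichmullerIdeal s) N

theorem isPrecomplete_teichmullerIdeal {s : Set S} (hs : s.Finite)
    [IsPrecomplete (Ideal.span s) S] :
    IsPrecomplete (teichmullerIdeal p s) (WittVector p S) := by
  refine ⟨fun f hf => ?_⟩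
  simp only [smul_eq_mul, Ideal.mul_top, SModEq.sub_mem] at hf ⊢
  have hlim (i : ℕ) : ∃ z : S, ∀ n, ∃ M, ∀ N ≥ M, (f N).coeff i - z ∈ Ideal.span s ^ n := by
    refine (Ideal.span s).exists_limit_of_cauchy fun n => ?_
    obtain ⟨M, hM⟩ := exists_teichmullerIdeal_pow_le_coeffIdeal (p := p) hs (i + 1) n
    exact ⟨M, fun N hN => sub_mem_coeffIdeal.1 (hM (hf hN)) i i.lt_succ_self⟩
  choose L hL using hlim
  refine ⟨mk p L, fun n => ?_⟩
  obtain ⟨q, hq⟩ := exists_coeffIdeal_le_teichmullerIdeal_pow (p := p) hs n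
  choose M hM using fun i => hL i q
  have hlast : f (n + ∑ i ∈ Finset.range n, M i) - mk p L ∈ teichmullerIdeal p s ^ n :=
    hq <| sub_mem_coeffIdeal.2 fun i hi => hM i _ <|
      (Finset.single_le_sum (f := M) (fun _ _ => Nat.zero_le _)
        (Finset.mem_range.2 hi)).trans (Nat.le_add_left _ _)
  exact sub_add_sub_cancel (f n) _ (mk p L) ▸ add_mem (hf (Nat.le_add_right n _)) hlast

end CharP

end WittVector

/-- Let `S` be a perfect commutative ring of characteristic `p`, let
`a₁, …, a_k ∈ S` and suppose `S` is separated and complete for the `(a₁, …, a_k)`-adic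
topology.  Then the ring of `p`-typical Witt vectors `W(S)` is separated and complete for
the `J`-adic topology, where `J` is generated by `p` together with the Teichmüller
representatives `[a₁], …, [a_k]`. -/
theorem wittVector_isAdicComplete
    (p : ℕ) [Fact p.Prime] (S : Type*) [CommRing S] [CharP S p] [ExpChar S p]
    [PerfectRing S p]
    (k : ℕ) (a : Fin k → S)
    (hS : IsAdicComplete (Ideal.span (Set.range a)) S) :
    IsAdicComplete
      (Ideal.span ({(p : WittVector p S)} ∪
        Set.range fun i => WittVector.teichmuller p (a i)))
      (WittVector p S) := by
  have hs := Set.finite_range a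
  have hJ : Ideal.span ({(p : WittVector p S)} ∪
      Set.range fun i => WittVector.teichmuller p (a i)) =
      WittVector.teichmullerIdeal p (Set.range a) := by
    rw [WittVector.teichmullerIdeal, ← Set.range_comp]
    rfl
  rw [hJ]
  have := WittVector.isHausdorff_teichmullerIdeal (p := p) hs
  have := WittVector.isPrecomplete_teichmullerIdeal (p := p) hs
  constructor
end

section
/- Let p be a prime and n ≥ 1. For each i ∈ {1, …, n}, let R_i be a ℤ_p-algebra and r_i ∈ R_i an element such that R_i is separated for the (r_i)-adic topology and p ∈ (r_i). For x ∈ R_i define ‖x‖_i = 2^{−m} where m is the largest natural number with x ∈ (r_i)^m (and ‖0‖_i = 0, since R_i is (r_i)-adically separated). On the tensor product T = R₁ ⊗_{ℤ_p} ⋯ ⊗_{ℤ_p} R_n define the tensor seminorm ‖t‖ as the infimum, over all finite representations t = Σ_{j∈J} a_j^1 ⊗ ⋯ ⊗ a_j^n with a_j^i ∈ R_i, of max_{j∈J} ∏_{i=1}^n ‖a_j^i‖_i. Let J_T denote the ideal of T generated by the images of r₁, …, r_n (i.e. by the elements 1 ⊗ ⋯ ⊗ r_i ⊗ ⋯ ⊗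 1). Then for every t ∈ T and every natural number m, one has ‖t‖ ≤ 2^{−m} if and only if t ∈ J_T^m. In particular, the topology induced on T by the tensor seminorm coincides with the J_T-adic topology, i.e. the (r₁, …, r_n)-adic topology. -/
open scoped TensorProduct

/-- The `I`-adic norm `‖x‖ = 2^{−m}`, where `m` is the largest natural number with
`x ∈ Iᵐ` (and `‖x‖ = 0` if `x` lies in all powers of `I`), realized as the infimum of
`(1/2)^m` over all `m` with `x ∈ Iᵐ`. -/
noncomputable def adicNormNN {A : Type*} [CommRing A] (I : Ideal A) (x : A) : NNReal :=
  sInf ((fun m : ℕ => (2⁻¹ : NNReal) ^ m) '' {m : ℕ | x ∈ I ^ m})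

/-- The tensor seminorm on `R₁ ⊗_{ℤ_p} ⋯ ⊗_{ℤ_p} R_n`: the infimum, over all finite
representations `t = Σ_j a_j^1 ⊗ ⋯ ⊗ a_j^n`, of `max_j ∏_i ‖a_j^i‖_i`, where `‖·‖_i` is
the `(r_i)`-adic norm on `R_i` (normalized by `‖r_i‖ = 1/2`). -/
noncomputable def piTensorSeminorm {p : ℕ} [Fact p.Prime] {n : ℕ} (R : Fin n → Type*)
    [∀ i, CommRing (R i)] [∀ i, Algebra ℤ_[p] (R i)] (r : ∀ i, R i)
    (t : ⨂[ℤ_[p]] i, R i) : NNReal :=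
  sInf { s : NNReal | ∃ (k : ℕ) (a : Fin k → ∀ i, R i),
    t = ∑ j : Fin k, (⨂ₜ[ℤ_[p]] i, a j i) ∧
    s = (Finset.univ : Finset (Fin k)).sup
      fun j => ∏ i : Fin n, adicNormNN (Ideal.span {r i}) (a j i) }

theorem adicNormNN_le_of_mem_pow {A : Type*} [CommRing A] {I : Ideal A} {x : A} {m : ℕ}
    (hx : x ∈ I ^ m) : adicNormNN I x ≤ (2⁻¹ : NNReal) ^ m :=
  csInf_le (OrderBot.bddBelow _) ⟨m, hx, rfl⟩

/-- Either `x` lies in all powers of `I`, or its adic norm is attained. -/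
theorem forall_mem_pow_or_adicNormNN_eq {A : Type*} [CommRing A] (I : Ideal A) (x : A) :
    (∀ m : ℕ, x ∈ I ^ m) ∨ ∃ m : ℕ, x ∈ I ^ m ∧ adicNormNN I x = (2⁻¹ : NNReal) ^ m := by
  refine or_iff_not_imp_left.mpr fun h => ?_
  obtain ⟨N, hN⟩ := not_forall.mp h
  have hbdd : BddAbove {m : ℕ | x ∈ I ^ m} :=
    ⟨N, fun m hm => le_of_not_ge fun hNm => hN (Ideal.pow_le_pow_right hNm hm)⟩
  have hmem := Nat.sSup_mem (s := {m : ℕ | x ∈ I ^ m}) ⟨0, by simp⟩ hbdd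
  refine ⟨_, hmem, IsLeast.csInf_eq ⟨⟨_, hmem, rfl⟩, ?_⟩⟩
  rintro _ ⟨k, hk, rfl⟩
  exact pow_le_pow_of_le_one zero_le (by norm_num [← one_div]) (le_csSup hbdd hk)

namespace PiTensorProduct

variable {K ι : Type*} [CommRing K] [Fintype ι] {A : ι → Type*}
  [∀ i, CommRing (A i)] [∀ i, Algebra K (A i)]

variable (K) in
/-- The pure tensors whose factors have `r i`-adic valuations adding up to at least `m`. -/
def pureTensorsOfDegree (r : ∀ i, A i) (m : ℕ) : Set (⨂[K] i, A i) :=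
  {t | ∃ (a : ∀ i, A i) (k : ι → ℕ),
    (∀ i, a i ∈ Ideal.span {r i} ^ k i) ∧ ∑ i, k i = m ∧ tprod K a = t}

theorem exists_eq_sum_tprod (r : ∀ i, A i) {m : ℕ} {t : ⨂[K] i, A i}
    (ht : t ∈ AddSubmonoid.closure (pureTensorsOfDegree K r m)) :
    ∃ (k : ℕ) (a : Fin k → ∀ i, A i), t = ∑ j, tprod K (a j) ∧
      ∀ j, ∏ i, adicNormNN (Ideal.span {r i}) (a j i) ≤ (2⁻¹ : NNReal) ^ m := by
  obtain ⟨l, hl, rfl⟩ := AddSubmonoid.exists_list_of_mem_closure ht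
  choose a k hk hsum hat using fun j : Fin l.length => hl l[j.1] (List.getElem_mem _)
  refine ⟨l.length, a, ?_, fun j => ?_⟩
  · simp_rw [hat, Fin.sum_univ_getElem]
  · rw [← hsum j, ← Finset.prod_pow_eq_pow_sum]
    exact Finset.prod_le_prod' fun i _ => adicNormNN_le_of_mem_pow (hk j i)

variable [DecidableEq ι]

variable (K) in
/-- The ideal of `⨂ A i` generated by the elements `1 ⊗ ⋯ ⊗ r i ⊗ ⋯ ⊗ 1`. -/
def idealOfFamily (r : ∀ i, A i) : Ideal (⨂[K] i, A i) :=
  Ideal.span (Set.range fun i => tprod K (Function.update (fun j => (1 : A j)) i (r i)))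

theorem tprod_mem_idealOfFamily_pow (r : ∀ i, A i) {a : ∀ i, A i} {k : ι → ℕ}
    (h : ∀ i, a i ∈ Ideal.span {r i} ^ k i) :
    tprod K a ∈ idealOfFamily K r ^ ∑ i, k i := by
  simp only [Ideal.span_singleton_pow, Ideal.mem_span_singleton] at h
  choose b hb using h
  have hsplit : tprod K a =
      (∏ i, tprod K (Function.update (fun j => (1 : A j)) i (r i)) ^ k i) * tprod K b := by
    have hprod : (fun i => r i ^ k i) = ∏ i, (Pi.mulSingle i (r i) : ∀ i, A i) ^ k i := by
      simp_rw [← Pi.mulSingle_pow]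
      exact (Finset.univ_prod_mulSingle _).symm
    have ha : a = (∏ i, (Pi.mulSingle i (r i) : ∀ i, A i) ^ k i) * b := by
      rw [← hprod]
      exact funext hb
    rw [ha, ← tprod_mul_tprod, tprod_prod]
    congr 1
    exact Finset.prod_congr rfl fun i _ => map_pow (tprodMonoidHom K) _ _
  rw [hsplit, ← Finset.prod_pow_eq_pow_sum]
  exact Ideal.mul_mem_right _ _ <| Ideal.prod_mem_prod fun i _ =>
    Ideal.pow_mem_pow (Ideal.subset_span (Set.mem_range_self i)) _

theorem mem_closure_pureTensorsOfDegree_zero [Nonempty ι] (r : ∀ i, A i) (t : ⨂[K] i, A i) :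
    t ∈ AddSubmonoid.closure (pureTensorsOfDegree K r 0) := by
  induction t using PiTensorProduct.induction_on' with
  | tprodCoeff c f =>
    obtain ⟨i⟩ := ‹Nonempty ι›
    refine AddSubmonoid.subset_closure
      ⟨Function.update f i (c • f i), fun _ => 0, by simp, by simp, ?_⟩
    rw [MultilinearMap.map_update_smul, Function.update_eq_self, tprodCoeff_eq_smul_tprod]
  | add x y hx hy => exact add_mem hx hy

theorem mul_mem_closure_pureTensorsOfDegree_succ (r : ∀ i, A i) (i : ι) {m : ℕ}
    {t : ⨂[K] i, A i} (ht : t ∈ AddSubmonoid.closure (pureTensorsOfDegree K r m)) :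
    tprod K (Function.update (fun j => (1 : A j)) i (r i)) * t ∈
      AddSubmonoid.closure (pureTensorsOfDegree K r (m + 1)) := by
  induction ht using AddSubmonoid.closure_induction with
  | mem x hx =>
    obtain ⟨a, k, hk, hsum, rfl⟩ := hx
    rw [tprod_mul_tprod]
    refine AddSubmonoid.subset_closure
      ⟨_, fun j => (if j = i then 1 else 0) + k j, fun j => ?_, ?_, rfl⟩
    · rw [pow_add]
      refine Ideal.mul_mem_mul ?_ (hk j)
      rcases eq_or_ne j i with rfl | hj
      · simp
      · simp [hj]
    · simp [Finset.sum_add_distrib, hsum, add_comm]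
  | zero => simp
  | add x y _ _ hx hy => rw [mul_add]; exact add_mem hx hy

theorem mem_closure_pureTensorsOfDegree [Nonempty ι] (r : ∀ i, A i) {m : ℕ} {t : ⨂[K] i, A i}
    (ht : t ∈ idealOfFamily K r ^ m) :
    t ∈ AddSubmonoid.closure (pureTensorsOfDegree K r m) := by
  induction m generalizing t with
  | zero => exact mem_closure_pureTensorsOfDegree_zero r t
  | succ m ih =>
    rw [pow_succ'] at ht
    refine Submodule.mul_induction_on ht (fun y hy x hx => ?_) fun _ _ => add_mem
    induction hy using Submodule.span_induction generalizing x with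
    | mem y hy =>
      obtain ⟨i, rfl⟩ := hy
      exact mul_mem_closure_pureTensorsOfDegree_succ r i (ih hx)
    | zero => simp
    | add y z _ _ hy hz => rw [add_mul]; exact add_mem (hy x hx) (hz x hx)
    | smul c y _ hy =>
      rw [smul_eq_mul, mul_comm c y, mul_assoc]
      exact hy _ (Ideal.mul_mem_left _ c hx)

/-- A pure tensor of small norm lies in a high power of the ideal generated by the `r i`. -/
theorem tprod_mem_idealOfFamily_pow_of_prod_adicNormNN_lt {r : ∀ i, A i}
    (hsep : ∀ i, ∀ x : A i, (∀ m : ℕ, x ∈ Ideal.span {r i} ^ m) → x = 0) {a : ∀ i, A i} {m : ℕ}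
    (h : ∏ i, adicNormNN (Ideal.span {r i}) (a i) < 2 * (2⁻¹ : NNReal) ^ m) :
    tprod K a ∈ idealOfFamily K r ^ m := by
  by_cases hzero : ∃ i, a i = 0
  · obtain ⟨i, hi⟩ := hzero
    rw [(tprod K).map_coord_zero i hi]
    exact zero_mem _
  have hnorm i := (forall_mem_pow_or_adicNormNN_eq (Ideal.span {r i}) (a i)).resolve_left
    fun hall => hzero ⟨i, hsep i _ hall⟩
  choose k hk hka using hnorm
  refine Ideal.pow_le_pow_right ?_ (tprod_mem_idealOfFamily_pow r hk)
  simp_rw [hka, Finset.prod_pow_eq_pow_sum] at h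
  by_contra! hlt
  refine h.not_ge ?_
  calc 2 * (2⁻¹ : NNReal) ^ m ≤ 2 * (2⁻¹ : NNReal) ^ (∑ i, k i + 1) := by
        gcongr 2 * ?_
        exact pow_le_pow_of_le_one zero_le (by norm_num [← one_div]) hlt
    _ = (2⁻¹ : NNReal) ^ ∑ i, k i := by rw [pow_succ']; simp

end PiTensorProduct

/-- For `ℤ_p`-algebras `R₁, …, R_n` (`n ≥ 1`), each separated for the
`(r_i)`-adic topology and with `p ∈ (r_i)`, the tensor seminorm on
`T = R₁ ⊗_{ℤ_p} ⋯ ⊗_{ℤ_p} R_n` satisfies: `‖t‖ ≤ 2^{−m}` if and only if `t` lies in the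
`m`-th power of the ideal `J_T` of `T` generated by the images `1 ⊗ ⋯ ⊗ r_i ⊗ ⋯ ⊗ 1` of
the `r_i`.  In particular the tensor-seminorm topology coincides with the
`(r₁, …, r_n)`-adic topology. -/
theorem piTensorSeminorm_le_iff_mem_pow
    {p : ℕ} [Fact p.Prime] {n : ℕ} (hn : 1 ≤ n)
    (R : Fin n → Type*) [∀ i, CommRing (R i)] [∀ i, Algebra ℤ_[p] (R i)]
    (r : ∀ i, R i)
    (hsep : ∀ i, ∀ x : R i, (∀ m : ℕ, x ∈ Ideal.span {r i} ^ m) → x = 0)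
    (hpr : ∀ i, ((p : ℕ) : R i) ∈ Ideal.span {r i})
    (t : ⨂[ℤ_[p]] i, R i) (m : ℕ) :
    piTensorSeminorm R r t ≤ (2⁻¹ : NNReal) ^ m ↔
      t ∈ (Ideal.span (Set.range fun i =>
          (⨂ₜ[ℤ_[p]] j, Function.update (fun j => (1 : R j)) i (r i) j)) :
        Ideal (⨂[ℤ_[p]] i, R i)) ^ m := by
  have : Nonempty (Fin n) := ⟨⟨0, hn⟩⟩
  change _ ↔ t ∈ PiTensorProduct.idealOfFamily ℤ_[p] r ^ m
  constructor
  · intro h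
    have hne : { s : NNReal | ∃ (k : ℕ) (a : Fin k → ∀ i, R i),
        t = ∑ j : Fin k, (⨂ₜ[ℤ_[p]] i, a j i) ∧
        s = (Finset.univ : Finset (Fin k)).sup
          fun j => ∏ i : Fin n, adicNormNN (Ideal.span {r i}) (a j i) }.Nonempty := by
      obtain ⟨k, a, ha⟩ := PiTensorProduct.exists_eq_sum_tprod r
        (PiTensorProduct.mem_closure_pureTensorsOfDegree_zero r t)
      exact ⟨_, k, a, ha.1, rfl⟩
    have hlt : piTensorSeminorm R r t < 2 * (2⁻¹ : NNReal) ^ m :=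
      h.trans_lt (lt_mul_of_one_lt_left (by positivity) one_lt_two)
    obtain ⟨_, ⟨k, a, rfl, rfl⟩, hs⟩ := exists_lt_of_csInf_lt hne hlt
    exact sum_mem fun j _ =>
      PiTensorProduct.tprod_mem_idealOfFamily_pow_of_prod_adicNormNN_lt hsep
        ((Finset.le_sup (f := fun j => ∏ i, adicNormNN (Ideal.span {r i}) (a j i))
          (Finset.mem_univ j)).trans_lt hs)
  · intro h
    obtain ⟨k, a, hsum, ha⟩ := PiTensorProduct.exists_eq_sum_tprod r
      (PiTensorProduct.mem_closure_pureTensorsOfDegree r h)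
    exact csInf_le_of_le (OrderBot.bddBelow _) ⟨k, a, hsum, rfl⟩
      (Finset.sup_le fun j _ => ha j)
end
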